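/- For every L there exists a constant A_L (depending only on L) such that for every segment Λ ⊂ ℤ with |Λ| = L, every x ∈ Λ, every N > 0 and every t ∈ [−1,1], ν_Λ^N[ exp( t (c(η_x) − ν_Λ^N[c(η_x)]) ) ] ≤ exp(A_L N t²). -/

import Mathlib

open scoped BigOperators

noncomputable section

/-- `cfact c k = c(k)! = c(1)⋯c(k)`, with `cfact c 0 = 1`. -/
def cfact (c : ℕ → ℝ) : ℕ → ℝ
  | 0 => 1
  | k + 1 => cfact c k * c (k + 1)

/-- The configuration obtained from `η` by moving one particle from `x` to `y` (`x ≠ y`),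
i.e. `η - δ^x + δ^y`. -/
def move (η : ℤ → ℕ) (x y : ℤ) : ℤ → ℕ :=
  fun z => if z = x then η x - 1 else if z = y then η y + 1 else η z

/-- Unnormalized weight of the canonical measure `ν_Λ^N` on configurations supported in `Λ`
with `N` particles: `∏_{x∈Λ} 1/c(η_x)!`. -/
def nuW (c : ℕ → ℝ) (Λ : Finset ℤ) (N : ℕ) : (ℤ → ℕ) → ℝ :=
  Set.indicator {η : ℤ → ℕ | (∀ x, x ∉ Λ → η x = 0) ∧ (∑ x ∈ Λ, η x) = N}
    (fun η => ∏ x ∈ Λ, (cfact c (η x))⁻¹)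

/-- Expectation with respect to the probability measure obtained by normalizing the
nonnegative weight `w`. -/
def wE (w f : (ℤ → ℕ) → ℝ) : ℝ :=
  (∑' η : ℤ → ℕ, w η * f η) / (∑' η : ℤ → ℕ, w η)

/-- Covariance `μ[f,g] = μ[f g] - μ[f] μ[g]`. -/
def wCov (w f g : (ℤ → ℕ) → ℝ) : ℝ :=
  wE w (fun η => f η * g η) - wE w f * wE w g

/-- Entropy `Ent_μ(f) = μ[f log f] - μ[f] log μ[f]` (note `Real.log 0 = 0`, giving the
convention `0 log 0 = 0`). -/
def wEnt (w f : (ℤ → ℕ) → ℝ) : ℝ :=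
  wE w (fun η => f η * Real.log (f η)) - wE w f * Real.log (wE w f)

/-- Dirichlet form of the zero-range process on `Λ`:
`E(f,g) = (1/2) Σ_{x∈Λ} Σ_{y∈Λ, |x-y|=1} μ[c(η_x) ∂_{xy}f ∂_{xy}g]`. -/
def wDir (c : ℕ → ℝ) (Λ : Finset ℤ) (w f g : (ℤ → ℕ) → ℝ) : ℝ :=
  wE w (fun η => (1 / 2) * ∑ x ∈ Λ, ∑ y ∈ Λ,
    if |x - y| = 1 then c (η x) * ((f (move η x y) - f η) * (g (move η x y) - g η)) else 0)

/-- Weight conditioned on the event `∑_{x ∈ Λ₁} η x = n`. -/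
def condW (w : (ℤ → ℕ) → ℝ) (Λ₁ : Finset ℤ) (n : ℕ) : (ℤ → ℕ) → ℝ :=
  Set.indicator {η : ℤ → ℕ | (∑ x ∈ Λ₁, η x) = n} w

/-- `h(n) = (n+1)/c(n+1)`. -/
def hfun (c : ℕ → ℝ) (n : ℕ) : ℝ := (n + 1) / c (n + 1)

open Finset in
lemma cheb_sum {ι : Type*} (s : Finset ι) (w u v : ι → ℝ) (hw : ∀ i ∈ s, 0 ≤ w i)
    (h : ∀ i ∈ s, ∀ j ∈ s, (u i - u j) * (v i - v j) ≤ 0) :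
    (∑ i ∈ s, w i) * (∑ i ∈ s, w i * u i * v i) ≤
      (∑ i ∈ s, w i * u i) * (∑ i ∈ s, w i * v i) := by
  have h1 : ∑ i ∈ s, ∑ j ∈ s, w i * w j * ((u i - u j) * (v i - v j)) ≤ 0 := by
    refine sum_nonpos fun i hi => sum_nonpos fun j hj => ?_
    exact mul_nonpos_of_nonneg_of_nonpos (mul_nonneg (hw i hi) (hw j hj)) (h i hi j hj)
  have h2 : ∑ i ∈ s, ∑ j ∈ s, w i * w j * ((u i - u j) * (v i - v j)) =
      2 * ((∑ i ∈ s, w i) * (∑ i ∈ s, w i * u i * v i)) -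
      2 * ((∑ i ∈ s, w i * u i) * (∑ i ∈ s, w i * v i)) := by
    have e1 := sum_mul_sum s s (fun i => w i * u i * v i) w
    have e2 := sum_mul_sum s s w (fun i => w i * u i * v i)
    have e3 := sum_mul_sum s s (fun i => w i * u i) (fun i => w i * v i)
    have e4 := sum_mul_sum s s (fun i => w i * v i) (fun i => w i * u i)
    have : ∑ i ∈ s, ∑ j ∈ s, w i * w j * ((u i - u j) * (v i - v j)) =
      (∑ i ∈ s, ∑ j ∈ s, (w i * u i * v i) * w j) + (∑ i ∈ s, ∑ j ∈ s, w i * (w j * u j * v j))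
      - (∑ i ∈ s, ∑ j ∈ s, (w i * u i) * (w j * v j))
      - (∑ i ∈ s, ∑ j ∈ s, (w i * v i) * (w j * u j)) := by
      simp only [← sum_add_distrib, ← sum_sub_distrib]
      refine sum_congr rfl fun i _ => sum_congr rfl fun j _ => ?_
      ring
    rw [this, ← e1, ← e2, ← e3, ← e4]
    ring
  linarith

/-- `f` is a positive weight with (monotone) rate function `c`. -/
structure GoodW (f c : ℕ → ℝ) : Prop where
  pos : ∀ n, 0 < f n
  zero : c 0 = 0
  step : ∀ n, f (n + 1) * c (n + 1) = f n
  mono : Monotone c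

/-- Convolution of weights. -/
def cconv (f g : ℕ → ℝ) (M : ℕ) : ℝ := ∑ p ∈ Finset.HasAntidiagonal.antidiagonal M, f p.1 * g p.2

lemma cconv_pos {f g : ℕ → ℝ} (hf : ∀ n, 0 < f n) (hg : ∀ n, 0 < g n) (M : ℕ) :
    0 < cconv f g M :=
  Finset.sum_pos (fun p _ => mul_pos (hf _) (hg _)) ⟨(0, M), by simp⟩

lemma shift_left {f c g : ℕ → ℝ} (hf : GoodW f c) (φ : ℕ → ℕ → ℝ) (M : ℕ) :
    ∑ p ∈ Finset.HasAntidiagonal.antidiagonal (M + 1), f p.1 * g p.2 * c p.1 * φ p.1 p.2 =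
      ∑ p ∈ Finset.HasAntidiagonal.antidiagonal M, f p.1 * g p.2 * φ (p.1 + 1) p.2 := by
  rw [Finset.Nat.sum_antidiagonal_succ]
  simp only [hf.zero, mul_zero, zero_mul, zero_add]
  refine Finset.sum_congr rfl fun p _ => ?_
  rw [← hf.step p.1]; ring

lemma shift_right {f g α : ℕ → ℝ} (hg : GoodW g α) (φ : ℕ → ℕ → ℝ) (M : ℕ) :
    ∑ p ∈ Finset.HasAntidiagonal.antidiagonal (M + 1), f p.1 * g p.2 * α p.2 * φ p.1 p.2 =
      ∑ p ∈ Finset.HasAntidiagonal.antidiagonal M, f p.1 * g p.2 * φ p.1 (p.2 + 1) := by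
  rw [Finset.Nat.sum_antidiagonal_succ']
  simp only [hg.zero, mul_zero, zero_mul, zero_add]
  refine Finset.sum_congr rfl fun p _ => ?_
  rw [← hg.step p.2]; ring

lemma shift_both {f c g α : ℕ → ℝ} (hf : GoodW f c) (hg : GoodW g α) (φ : ℕ → ℝ) (M : ℕ) :
    ∑ p ∈ Finset.HasAntidiagonal.antidiagonal M, f p.1 * g p.2 * c p.1 * φ p.1 =
      ∑ p ∈ Finset.HasAntidiagonal.antidiagonal M, f p.1 * g p.2 * α p.2 * φ (p.1 + 1) := by
  cases M with
  | zero => simp [hf.zero, hg.zero]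
  | succ M =>
    rw [shift_left hf (fun i _ => φ i), shift_right hg (fun i _ => φ (i + 1))]

lemma anti_aux {M : ℕ} {α u : ℕ → ℝ} (hα : Monotone α) (hu : Monotone u) :
    ∀ p ∈ Finset.HasAntidiagonal.antidiagonal M, ∀ q ∈ Finset.HasAntidiagonal.antidiagonal M,
      (α p.2 - α q.2) * (u p.1 - u q.1) ≤ 0 := by
  intro p hp q hq
  rw [Finset.HasAntidiagonal.mem_antidiagonal] at hp hq
  rcases le_total p.1 q.1 with h | h
  · have h' : q.2 ≤ p.2 := by omega
    exact mul_nonpos_of_nonneg_of_nonpos (sub_nonneg.2 (hα h')) (sub_nonpos.2 (hu h))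
  · have h' : p.2 ≤ q.2 := by omega
    exact mul_nonpos_of_nonpos_of_nonneg (sub_nonpos.2 (hα h')) (sub_nonneg.2 (hu h))

lemma GoodW.cconv {f c g α : ℕ → ℝ} (hf : GoodW f c) (hg : GoodW g α) :
    ∃ β, GoodW (cconv f g) β := by
  have hpos := cconv_pos hf.pos hg.pos
  refine ⟨fun M => (∑ p ∈ Finset.HasAntidiagonal.antidiagonal M, f p.1 * g p.2 * c p.1) / _root_.cconv f g M,
    hpos, ?_, ?_, ?_⟩
  · simp [hf.zero]
  · intro n
    rw [mul_div_cancel₀ _ (hpos _).ne']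
    simpa using! shift_left (g := g) hf (fun _ _ => 1) n
  · refine monotone_nat_of_le_succ fun M => ?_
    have h1 : ∑ p ∈ Finset.HasAntidiagonal.antidiagonal (M + 1), f p.1 * g p.2 * c p.1 = _root_.cconv f g M := by
      simpa using! shift_left (g := g) hf (fun _ _ => 1) M
    have h2 : ∑ p ∈ Finset.HasAntidiagonal.antidiagonal (M + 1), f p.1 * g p.2 * α p.2 = _root_.cconv f g M := by
      simpa using! shift_right (f := f) hg (fun _ _ => 1) M
    have h3 : ∑ p ∈ Finset.HasAntidiagonal.antidiagonal (M + 1), f p.1 * g p.2 * α p.2 * c p.1 =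
        ∑ p ∈ Finset.HasAntidiagonal.antidiagonal M, f p.1 * g p.2 * c p.1 :=
      shift_right (f := f) hg (fun i _ => c i) M
    have h4 := cheb_sum (Finset.HasAntidiagonal.antidiagonal (M + 1)) (fun p => f p.1 * g p.2)
      (fun p => α p.2) (fun p => c p.1) (fun p _ => (mul_pos (hf.pos _) (hg.pos _)).le)
      (anti_aux hg.mono hf.mono)
    rw [h1, h2, h3] at h4
    rw [h1, div_le_div_iff₀ (hpos _) (hpos _), mul_comm]
    exact h4

lemma tilt_bound {f c g α : ℕ → ℝ} (hf : GoodW f c) (hg : GoodW g α) {D : ℝ}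
    (hD : 0 ≤ D) (hinc : ∀ n, c (n + 1) ≤ c n + D) (N : ℕ) :
    ∃ μ : ℝ, ∀ t : ℝ, |t| ≤ 2 →
      ∑ p ∈ Finset.HasAntidiagonal.antidiagonal N, f p.1 * g p.2 * Real.exp (t * (c p.1 - μ)) ≤
        Real.exp (D ^ 2 * Real.exp (2 * D) * N * t ^ 2) *
          ∑ p ∈ Finset.HasAntidiagonal.antidiagonal N, f p.1 * g p.2 := by
  set S := Finset.HasAntidiagonal.antidiagonal N
  set H := ∑ p ∈ S, f p.1 * g p.2 with hH
  have hHpos : 0 < H := cconv_pos hf.pos hg.pos N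
  have hw : ∀ p ∈ S, 0 ≤ f p.1 * g p.2 := fun p _ => (mul_pos (hf.pos _) (hg.pos _)).le
  have hα0 : ∀ n, 0 ≤ α n := fun n => hg.zero ▸ hg.mono (Nat.zero_le n)
  have hcle : ∀ n, c n ≤ D * n := by
    intro n
    induction n with
    | zero => simp [hf.zero]
    | succ n ih => push_cast; linarith [hinc n]
  set μ := (∑ p ∈ S, f p.1 * g p.2 * c p.1) / H with hμ
  have hμH : ∑ p ∈ S, f p.1 * g p.2 * c p.1 = H * μ := by
    rw [hμ, mul_div_cancel₀ _ hHpos.ne']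
  have hμα : ∑ p ∈ S, f p.1 * g p.2 * α p.2 = H * μ := by
    rw [← hμH]; simpa using! (shift_both hf hg (fun _ => 1) N).symm
  have hc0 : ∀ n, 0 ≤ c n := fun n => hf.zero ▸ hf.mono (Nat.zero_le n)
  have hμ0 : 0 ≤ μ := by
    apply div_nonneg _ hHpos.le
    exact Finset.sum_nonneg fun p hp => mul_nonneg (hw p hp) (hc0 _)
  have hμN : μ ≤ D * N := by
    rw [hμ, div_le_iff₀ hHpos, hH, Finset.mul_sum]
    refine Finset.sum_le_sum fun p hp => ?_
    rw [mul_comm]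
    refine mul_le_mul_of_nonneg_right ((hcle _).trans ?_) (hw p hp)
    have : p.1 ≤ N := by have := Finset.HasAntidiagonal.mem_antidiagonal.1 hp; omega
    gcongr
  refine ⟨μ, fun t ht => ?_⟩
  set G := ∑ p ∈ S, f p.1 * g p.2 * Real.exp (t * c p.1) with hG
  have hGpos : 0 < G := by
    refine Finset.sum_pos (fun p _ => ?_) ⟨(0, N), by simp [S]⟩
    exact mul_pos (mul_pos (hf.pos _) (hg.pos _)) (Real.exp_pos _)
  set Q := ∑ p ∈ S, f p.1 * g p.2 * c p.1 * Real.exp (t * c p.1) with hQ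
  have hQ' : Q = ∑ p ∈ S, f p.1 * g p.2 * α p.2 * Real.exp (t * c (p.1 + 1)) :=
    shift_both hf hg (fun i => Real.exp (t * c i)) N
  set R := ∑ p ∈ S, f p.1 * g p.2 * α p.2 * Real.exp (t * c p.1) with hR
  -- key: t * Q ≤ t * (e^{tD} μ G)
  have key : t * Q ≤ t * (Real.exp (t * D) * (μ * G)) := by
    rcases le_total 0 t with h0 | h0
    · refine mul_le_mul_of_nonneg_left ?_ h0
      have h1 : Q ≤ Real.exp (t * D) * R := by
        rw [hQ', hR, Finset.mul_sum]
        refine Finset.sum_le_sum fun p hp => ?_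
        have : Real.exp (t * c (p.1 + 1)) ≤ Real.exp (t * D) * Real.exp (t * c p.1) := by
          rw [← Real.exp_add, Real.exp_le_exp]
          nlinarith [hinc p.1]
        calc _ ≤ f p.1 * g p.2 * α p.2 * (Real.exp (t * D) * Real.exp (t * c p.1)) :=
              mul_le_mul_of_nonneg_left this (mul_nonneg (hw p hp) (hα0 _))
          _ = _ := by ring
      have h2 : H * R ≤ (H * μ) * G := by
        rw [← hμα]
        refine cheb_sum S (fun p => f p.1 * g p.2) (fun p => α p.2)
          (fun p => Real.exp (t * c p.1)) hw (anti_aux (u := fun n => Real.exp (t * c n)) hg.mono ?_)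
        intro a b hab
        exact Real.exp_le_exp.2 (mul_le_mul_of_nonneg_left (hf.mono hab) h0)
      have h3 : R ≤ μ * G := by
        rw [mul_assoc] at h2
        exact le_of_mul_le_mul_left h2 hHpos
      exact h1.trans (mul_le_mul_of_nonneg_left h3 (Real.exp_pos _).le)
    · refine mul_le_mul_of_nonpos_left ?_ h0
      have h1 : Real.exp (t * D) * R ≤ Q := by
        rw [hQ', hR, Finset.mul_sum]
        refine Finset.sum_le_sum fun p hp => ?_
        have : Real.exp (t * D) * Real.exp (t * c p.1) ≤ Real.exp (t * c (p.1 + 1)) := by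
          rw [← Real.exp_add, Real.exp_le_exp]
          nlinarith [hinc p.1]
        calc _ = f p.1 * g p.2 * α p.2 * (Real.exp (t * D) * Real.exp (t * c p.1)) := by ring
          _ ≤ _ := mul_le_mul_of_nonneg_left this (mul_nonneg (hw p hp) (hα0 _))
      have h2 : (H * μ) * G ≤ H * R := by
        rw [← hμα]
        have := cheb_sum S (fun p => f p.1 * g p.2) (fun p => α p.2)
          (fun p => - Real.exp (t * c p.1)) hw
          (anti_aux (u := fun n => - Real.exp (t * c n)) hg.mono ?_)
        · simp only [mul_neg, Finset.sum_neg_distrib] at this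
          exact neg_le_neg_iff.1 this
        intro a b hab
        exact neg_le_neg (Real.exp_le_exp.2 (mul_le_mul_of_nonpos_left (hf.mono hab) h0))
      have h3 : μ * G ≤ R := by
        rw [mul_assoc] at h2
        exact le_of_mul_le_mul_left h2 hHpos
      exact (mul_le_mul_of_nonneg_left h3 (Real.exp_pos _).le).trans h1
  -- Jensen
  set b := t * Q / G with hb
  have hbG : b * G = t * Q := by rw [hb, div_mul_cancel₀ _ hGpos.ne']
  have jen : Real.exp (-b) * G ≤ H := by
    have : ∑ p ∈ S, f p.1 * g p.2 * Real.exp (t * c p.1) *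
        (Real.exp (-b) * (1 - t * c p.1 + b)) ≤ H := by
      refine Finset.sum_le_sum fun p hp => ?_
      rw [mul_assoc]
      refine mul_le_of_le_one_right (hw p hp) ?_
      have h1 : 1 - t * c p.1 + b ≤ Real.exp (b - t * c p.1) := by
        linarith [Real.add_one_le_exp (b - t * c p.1)]
      calc _ ≤ Real.exp (t * c p.1) * (Real.exp (-b) * Real.exp (b - t * c p.1)) := by gcongr
        _ = 1 := by
          rw [← Real.exp_add, ← Real.exp_add, Real.exp_eq_one_iff]; ring
    have e : ∑ p ∈ S, f p.1 * g p.2 * Real.exp (t * c p.1) *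
        (Real.exp (-b) * (1 - t * c p.1 + b)) = Real.exp (-b) * (G - t * Q + b * G) := by
      rw [hG, hQ, mul_add, mul_sub]
      simp only [Finset.mul_sum]
      rw [← Finset.sum_sub_distrib, ← Finset.sum_add_distrib]
      exact Finset.sum_congr rfl fun p _ => by ring
    rw [e, hbG] at this
    simpa using this
  have hGle : G ≤ Real.exp b * H := by
    have := mul_le_mul_of_nonneg_left jen (Real.exp_pos b).le
    rwa [← mul_assoc, ← Real.exp_add, add_neg_cancel, Real.exp_zero, one_mul] at this
  have hble : b ≤ t * Real.exp (t * D) * μ := by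
    rw [hb, div_le_iff₀ hGpos]; linarith
  have hlhs : ∑ p ∈ S, f p.1 * g p.2 * Real.exp (t * (c p.1 - μ)) = Real.exp (-(t * μ)) * G := by
    rw [hG, Finset.mul_sum]
    refine Finset.sum_congr rfl fun p _ => ?_
    rw [show t * (c p.1 - μ) = -(t * μ) + t * c p.1 by ring, Real.exp_add]; ring
  rw [hlhs]
  have hscal : t * (Real.exp (t * D) - 1) ≤ t ^ 2 * (D * Real.exp (2 * D)) := by
    have ht' := abs_le.1 ht
    rcases le_total 0 t with h0 | h0
    · have h1 : Real.exp (t * D) - 1 ≤ t * D * Real.exp (t * D) := by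
        have := Real.add_one_le_exp (-(t * D))
        have h2 : Real.exp (-(t * D)) * Real.exp (t * D) = 1 := by rw [← Real.exp_add]; simp
        nlinarith [Real.exp_pos (t * D)]
      have h2 : Real.exp (t * D) ≤ Real.exp (2 * D) :=
        Real.exp_le_exp.2 (mul_le_mul_of_nonneg_right ht'.2 hD)
      calc _ ≤ t * (t * D * Real.exp (2 * D)) := by
            refine mul_le_mul_of_nonneg_left (h1.trans ?_) h0
            exact mul_le_mul_of_nonneg_left h2 (mul_nonneg h0 hD)
        _ = _ := by ring
    · have h1 : t * D ≤ Real.exp (t * D) - 1 := by linarith [Real.add_one_le_exp (t * D)]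
      have h2 : 1 ≤ Real.exp (2 * D) := Real.one_le_exp (by positivity)
      calc _ ≤ t * (t * D) := mul_le_mul_of_nonpos_left h1 h0
        _ = t ^ 2 * (D * 1) := by ring
        _ ≤ _ := by gcongr
  calc Real.exp (-(t * μ)) * G ≤ Real.exp (-(t * μ)) * (Real.exp (t * Real.exp (t * D) * μ) * H) := by
        refine mul_le_mul_of_nonneg_left (hGle.trans ?_) (Real.exp_pos _).le
        exact mul_le_mul_of_nonneg_right (Real.exp_le_exp.2 hble) hHpos.le
    _ = Real.exp (t * (Real.exp (t * D) - 1) * μ) * H := by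
        rw [← mul_assoc, ← Real.exp_add]; congr 2; ring
    _ ≤ _ := by
        refine mul_le_mul_of_nonneg_right (Real.exp_le_exp.2 ?_) hHpos.le
        calc _ ≤ t ^ 2 * (D * Real.exp (2 * D)) * μ := mul_le_mul_of_nonneg_right hscal hμ0
          _ ≤ t ^ 2 * (D * Real.exp (2 * D)) * (D * N) := by gcongr
          _ = _ := by ring

/-- Canonical partition function. -/
def Zs (f : ℕ → ℝ) (s : Finset ℤ) (N : ℕ) : ℝ :=
  ∑ η ∈ Finset.piAntidiag s N, ∏ y ∈ s, f (η y)

lemma sum_cons_Zs (f φ : ℕ → ℝ) (s : Finset ℤ) (x : ℤ) (hx : x ∉ s) (N : ℕ) :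
    ∑ η ∈ Finset.piAntidiag (Finset.cons x s hx) N,
      (∏ y ∈ Finset.cons x s hx, f (η y)) * φ (η x) =
    ∑ p ∈ Finset.HasAntidiagonal.antidiagonal N, f p.1 * Zs f s p.2 * φ p.1 := by
  rw [Finset.piAntidiag_cons, Finset.sum_disjiUnion]
  refine Finset.sum_congr rfl fun p _ => ?_
  rw [Finset.sum_map, Zs, Finset.mul_sum, Finset.sum_mul]
  refine Finset.sum_congr rfl fun η hη => ?_
  have h0 : η x = 0 := by
    by_contra h
    exact hx ((Finset.mem_piAntidiag.1 hη).2 x h)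
  rw [Finset.prod_cons]
  simp only [addRightEmbedding_apply, Pi.add_apply, h0, if_true, zero_add]
  congr 2
  refine Finset.prod_congr rfl fun y hy => ?_
  have : y ≠ x := fun h => hx (h ▸ hy)
  simp [this]

lemma Zs_good {f c : ℕ → ℝ} (hf : GoodW f c) (s : Finset ℤ) (hs : s.Nonempty) :
    ∃ β, GoodW (Zs f s) β := by
  induction hs using Finset.Nonempty.cons_induction with
  | singleton a =>
    refine ⟨c, ?_⟩
    have : Zs f {a} = f := by
      funext N
      have h := sum_cons_Zs f (fun _ => 1) ∅ a (by simp) N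
      simp only [mul_one] at h
      change ∑ η ∈ Finset.piAntidiag {a} N, ∏ y ∈ ({a} : Finset ℤ), f (η y) = f N
      refine h.trans ?_
      rw [Finset.sum_eq_single (N, 0)]
      · simp [Zs]
      · rintro ⟨i, j⟩ hp hne
        have hp := Finset.HasAntidiagonal.mem_antidiagonal.1 hp
        have : j ≠ 0 := by rintro rfl; simp_all
        simp [Zs, Finset.piAntidiag_empty_of_ne_zero this]
      · simp
    rwa [this]
  | cons a s h hs ih =>
    obtain ⟨β, hβ⟩ := ih
    obtain ⟨γ, hγ⟩ := hf.cconv hβ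
    refine ⟨γ, ?_⟩
    have : Zs f (Finset.cons a s h) = cconv f (Zs f s) := by
      funext N
      simpa using! sum_cons_Zs f (fun _ => 1) s a h N
    rwa [this]

lemma site_bound {f c : ℕ → ℝ} (hf : GoodW f c) {D : ℝ}
    (hD : 0 ≤ D) (hinc : ∀ n, c (n + 1) ≤ c n + D) (N : ℕ) (Λ : Finset ℤ) (x : ℤ) (hx : x ∈ Λ) :
    ∃ μ : ℝ, ∀ t : ℝ, |t| ≤ 2 →
      ∑ η ∈ Finset.piAntidiag Λ N, (∏ y ∈ Λ, f (η y)) * Real.exp (t * (c (η x) - μ)) ≤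
        Real.exp (D ^ 2 * Real.exp (2 * D) * N * t ^ 2) *
          ∑ η ∈ Finset.piAntidiag Λ N, ∏ y ∈ Λ, f (η y) := by
  obtain ⟨s, hxs, rfl⟩ : ∃ s : Finset ℤ, ∃ h : x ∉ s, Λ = Finset.cons x s h :=
    ⟨Λ.erase x, by simp, by simp [Finset.insert_erase hx]⟩
  rcases s.eq_empty_or_nonempty with rfl | hs
  · refine ⟨c N, fun t _ => ?_⟩
    rw [Finset.mul_sum]
    refine Finset.sum_le_sum fun η hη => ?_
    have : η x = N := by simpa using (Finset.mem_piAntidiag.1 hη).1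
    rw [this, sub_self, mul_zero, Real.exp_zero, mul_one]
    refine le_mul_of_one_le_left (Finset.prod_nonneg fun y _ => (hf.pos _).le) ?_
    exact Real.one_le_exp (by positivity)
  · obtain ⟨α, hα⟩ := Zs_good hf s hs
    obtain ⟨μ, h⟩ := tilt_bound hf hα hD hinc N
    refine ⟨μ, fun t ht => ?_⟩
    have e1 := sum_cons_Zs f (fun n => Real.exp (t * (c n - μ))) s x hxs N
    have e2 := sum_cons_Zs f (fun _ => 1) s x hxs N
    simp only [mul_one] at e2
    rw [e1, e2]
    exact h t ht

lemma cfact_add (c : ℕ → ℝ) (n m : ℕ) :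
    cfact c (n + m) = cfact c n * ∏ i ∈ Finset.range m, c (n + i + 1) := by
  induction m with
  | zero => simp
  | succ m ih =>
    rw [Finset.prod_range_succ, ← mul_assoc, ← ih]
    rfl

lemma cfact_pos {c : ℕ → ℝ} (hc : ∀ n, 0 < n → 0 < c n) (n : ℕ) : 0 < cfact c n := by
  induction n with
  | zero => simp [cfact]
  | succ n ih => exact mul_pos ih (hc _ n.succ_pos)

lemma cfact_compare {u v : ℕ → ℝ} (hu : ∀ n, 0 < n → 0 < u n) (hv : ∀ n, 0 < n → 0 < v n)
    {R : ℝ} (hR : 1 ≤ R) (huv : ∀ n, 0 < n → u n ≤ R * v n) {B : ℕ} (hB : 0 < B)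
    (hblock : ∀ q, cfact u (q * B) = cfact v (q * B)) (n : ℕ) :
    cfact u n ≤ R ^ B * cfact v n := by
  have hn : n = n / B * B + n % B := (Nat.div_add_mod' n B).symm
  rw [hn, cfact_add, cfact_add, hblock]
  have h1 : ∏ i ∈ Finset.range (n % B), u (n / B * B + i + 1) ≤
      ∏ i ∈ Finset.range (n % B), (R * v (n / B * B + i + 1)) :=
    Finset.prod_le_prod (fun i _ => (hu _ (Nat.succ_pos _)).le) fun i _ => huv _ (Nat.succ_pos _)
  rw [Finset.prod_mul_distrib, Finset.prod_const, Finset.card_range] at h1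
  have h2 : R ^ (n % B) ≤ R ^ B := pow_le_pow_right₀ hR (Nat.mod_lt n hB).le
  have h3 : 0 ≤ ∏ i ∈ Finset.range (n % B), v (n / B * B + i + 1) :=
    Finset.prod_nonneg fun i _ => (hv _ (Nat.succ_pos _)).le
  calc _ ≤ cfact v (n / B * B) * (R ^ B * ∏ i ∈ Finset.range (n % B), v (n / B * B + i + 1)) := by
        refine mul_le_mul_of_nonneg_left (h1.trans ?_) (cfact_pos hv _).le
        exact mul_le_mul_of_nonneg_right h2 h3
    _ = _ := by ring

lemma smooth (c : ℕ → ℝ) (a₁ a₂ : ℝ) (k₀ : ℕ)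
    (hc0 : c 0 = 0) (hcpos : ∀ n : ℕ, 0 < n → 0 < c n)
    (hLG : ∀ k : ℕ, |c (k + 1) - c k| ≤ a₁)
    (hk₀ : 0 < k₀) (ha₂ : 0 < a₂)
    (hM : ∀ j k : ℕ, j + k₀ ≤ k → a₂ ≤ c k - c j) :
    ∃ (c' : ℕ → ℝ) (K K₁ : ℝ), 1 ≤ K ∧ 0 ≤ K₁ ∧ c' 0 = 0 ∧ (∀ n : ℕ, 0 < n → 0 < c' n) ∧
      Monotone c' ∧ (∀ n, |c n - c' n| ≤ K₁) ∧
      (∀ n, (cfact c n)⁻¹ ≤ K * (cfact c' n)⁻¹) ∧ (∀ n, (cfact c' n)⁻¹ ≤ K * (cfact c n)⁻¹) := by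
  have ha₁ : 0 ≤ a₁ := (abs_nonneg _).trans (hLG 0)
  have hlip : ∀ n d : ℕ, |c (n + d) - c n| ≤ a₁ * d := by
    intro n d
    induction d with
    | zero => simp
    | succ d ih =>
      have := abs_sub_le (c (n + (d + 1))) (c (n + d)) (c n)
      have h2 := hLG (n + d)
      rw [← add_assoc] at this ⊢
      push_cast
      linarith
  obtain ⟨ε, hε, hεc⟩ : ∃ ε > 0, ∀ n, 0 < n → ε ≤ c n := by
    obtain ⟨m, hm, hmin⟩ := Finset.exists_min_image (Finset.Icc 1 k₀) c ⟨1, by simp; omega⟩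
    rw [Finset.mem_Icc] at hm
    refine ⟨min a₂ (c m), lt_min ha₂ (hcpos m hm.1), fun n hn => ?_⟩
    rcases le_total n k₀ with h | h
    · exact (min_le_right _ _).trans (hmin n (Finset.mem_Icc.2 ⟨hn, h⟩))
    · have := hM 0 n (by omega)
      rw [hc0, sub_zero] at this
      exact (min_le_left _ _).trans this
  set P : ℕ → ℝ := fun q => ∏ i ∈ Finset.range k₀, c (q * k₀ + i + 1) with hP
  have hPpos : ∀ q, 0 < P q := fun q => Finset.prod_pos fun i _ => hcpos _ (Nat.succ_pos _)
  set G : ℕ → ℝ := fun q => (P q) ^ ((k₀ : ℝ)⁻¹) with hG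
  have hGpos : ∀ q, 0 < G q := fun q => Real.rpow_pos_of_pos (hPpos q) _
  have hGpow : ∀ q, G q ^ k₀ = P q := fun q => Real.rpow_inv_natCast_pow (hPpos q).le hk₀.ne'
  have hGle : ∀ q v, 0 ≤ v → (∀ i < k₀, c (q * k₀ + i + 1) ≤ v) → G q ≤ v := by
    intro q v hv h
    refine le_of_pow_le_pow_left₀ hk₀.ne' hv ?_
    rw [hGpow]
    calc P q ≤ ∏ i ∈ Finset.range k₀, v := Finset.prod_le_prod
          (fun i _ => (hcpos _ (Nat.succ_pos _)).le) fun i hi => h i (Finset.mem_range.1 hi)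
      _ = v ^ k₀ := by simp
  have hGge : ∀ q v, 0 ≤ v → (∀ i < k₀, v ≤ c (q * k₀ + i + 1)) → v ≤ G q := by
    intro q v hv h
    refine le_of_pow_le_pow_left₀ hk₀.ne' (hGpos q).le ?_
    rw [hGpow]
    calc v ^ k₀ = ∏ i ∈ Finset.range k₀, v := by simp
      _ ≤ P q := Finset.prod_le_prod (fun i _ => hv) fun i hi => h i (Finset.mem_range.1 hi)
  have hGmono : Monotone G := by
    refine monotone_nat_of_le_succ fun q => ?_
    refine Real.rpow_le_rpow (hPpos q).le ?_ (by positivity)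
    refine Finset.prod_le_prod (fun i _ => (hcpos _ (Nat.succ_pos _)).le) fun i _ => ?_
    have := hM (q * k₀ + i + 1) ((q + 1) * k₀ + i + 1) (by ring_nf; omega)
    linarith
  have hblockdiff : ∀ q i j, i < k₀ → j < k₀ →
      |c (q * k₀ + i + 1) - c (q * k₀ + j + 1)| ≤ a₁ * k₀ := by
    have aux : ∀ q i j, i ≤ j → j < k₀ →
      |c (q * k₀ + j + 1) - c (q * k₀ + i + 1)| ≤ a₁ * k₀ := by
      intro q i j hij hj
      have := hlip (q * k₀ + i + 1) (j - i)
      rw [show q * k₀ + i + 1 + (j - i) = q * k₀ + j + 1 by omega] at this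
      refine this.trans (mul_le_mul_of_nonneg_left ?_ ha₁)
      exact_mod_cast (by omega : j - i ≤ k₀)
    intro q i j hi hj
    rcases le_total i j with h | h
    · rw [abs_sub_comm]; exact aux q i j h hj
    · exact aux q j i h hi
  set K₁ := a₁ * k₀ with hK₁
  have hK₁0 : 0 ≤ K₁ := by positivity
  set c' : ℕ → ℝ := fun n => if n = 0 then 0 else G ((n - 1) / k₀) with hc'
  have hc's : ∀ n, c' (n + 1) = G (n / k₀) := fun n => by simp [hc']
  have hc'0 : c' 0 = 0 := by simp [hc']
  have hc'pos : ∀ n, 0 < n → 0 < c' n := by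
    intro n hn
    obtain ⟨n, rfl⟩ := Nat.exists_eq_succ_of_ne_zero hn.ne'
    rw [Nat.succ_eq_add_one, hc's]; exact hGpos _
  have hdiff : ∀ n, |c n - c' n| ≤ K₁ := by
    intro n
    cases n with
    | zero => simpa [hc0, hc'0] using hK₁0
    | succ n =>
      rw [hc's]
      have hn : n / k₀ * k₀ + n % k₀ = n := Nat.div_add_mod' n k₀
      have hlt := Nat.mod_lt n hk₀
      have hd : ∀ i < k₀, |c (n + 1) - c (n / k₀ * k₀ + i + 1)| ≤ K₁ := by
        intro i hi
        have := hblockdiff (n / k₀) (n % k₀) i hlt hi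
        rwa [hn] at this
      have hp := hcpos (n + 1) n.succ_pos
      have h1 : G (n / k₀) ≤ c (n + 1) + K₁ := by
        refine hGle _ _ (by linarith) fun i hi => ?_
        have := (abs_le.1 (hd i hi)).1
        linarith
      have h2 : c (n + 1) - K₁ ≤ G (n / k₀) := by
        rcases le_total (c (n + 1) - K₁) 0 with h | h
        · exact h.trans (hGpos _).le
        · refine hGge _ _ h fun i hi => ?_
          have := (abs_le.1 (hd i hi)).2
          linarith
      rw [abs_le]; constructor <;> linarith
  have hεc' : ∀ n, 0 < n → ε ≤ c' n := by
    intro n hn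
    obtain ⟨n, rfl⟩ := Nat.exists_eq_succ_of_ne_zero hn.ne'
    rw [Nat.succ_eq_add_one, hc's]
    exact hGge _ _ hε.le fun i _ => hεc _ (Nat.succ_pos _)
  have hratio : ∀ u v : ℝ, ε ≤ v → |u - v| ≤ K₁ → u ≤ (1 + K₁ / ε) * v := by
    intro u v hv huv
    have h1 := (abs_le.1 huv).2
    have h2 : K₁ ≤ K₁ / ε * v := by
      rw [div_mul_eq_mul_div, le_div_iff₀ hε]
      exact mul_le_mul_of_nonneg_left hv hK₁0
    linarith
  have hR : 1 ≤ 1 + K₁ / ε := by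
    have : 0 ≤ K₁ / ε := by positivity
    linarith
  have hblock : ∀ q, cfact c' (q * k₀) = cfact c (q * k₀) := by
    intro q
    induction q with
    | zero => simp [cfact]
    | succ q ih =>
      rw [add_mul, one_mul, cfact_add, cfact_add, ih]
      congr 1
      calc ∏ i ∈ Finset.range k₀, c' (q * k₀ + i + 1) = ∏ i ∈ Finset.range k₀, G q := by
            refine Finset.prod_congr rfl fun i hi => ?_
            rw [hc's]
            congr 1
            have := Finset.mem_range.1 hi
            rw [mul_comm, Nat.mul_add_div hk₀, Nat.div_eq_of_lt this, add_zero]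
        _ = G q ^ k₀ := by simp
        _ = _ := hGpow q
  refine ⟨c', (1 + K₁ / ε) ^ k₀, K₁, one_le_pow₀ hR, hK₁0, hc'0, hc'pos, ?_, hdiff, ?_, ?_⟩
  · refine monotone_nat_of_le_succ fun n => ?_
    cases n with
    | zero => rw [hc'0]; exact (hc'pos _ (Nat.succ_pos _)).le
    | succ n => rw [hc's, hc's]; exact hGmono (Nat.div_le_div_right (Nat.le_succ n))
  · intro n
    have h := cfact_compare hc'pos hcpos hR (fun n hn => hratio _ _ (hεc n hn)
      (by rw [abs_sub_comm]; exact hdiff n)) hk₀ hblock n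
    rw [← div_eq_mul_inv, le_div_iff₀ (cfact_pos hc'pos n), inv_mul_le_iff₀ (cfact_pos hcpos n),
      mul_comm]
    exact h
  · intro n
    have h := cfact_compare hcpos hc'pos hR (fun n hn => hratio _ _ (hεc' n hn)
      (hdiff n)) hk₀ (fun q => (hblock q).symm) n
    rw [← div_eq_mul_inv, le_div_iff₀ (cfact_pos hcpos n), inv_mul_le_iff₀ (cfact_pos hc'pos n),
      mul_comm]
    exact h

lemma exp_quad (x : ℝ) : Real.exp x ≤ 1 + x + x ^ 2 * Real.exp |x| := by
  have h := Complex.norm_exp_sub_sum_le_norm_mul_exp (x : ℂ) 2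
  have e : Complex.exp (x : ℂ) - ∑ m ∈ Finset.range 2, (x : ℂ) ^ m / (m.factorial : ℂ) =
      ((Real.exp x - 1 - x : ℝ) : ℂ) := by
    simp [Finset.sum_range_succ]; ring
  rw [e, Complex.norm_real, Complex.norm_real, Real.norm_eq_abs, Real.norm_eq_abs, sq_abs] at h
  linarith [le_abs_self (Real.exp x - 1 - x)]

lemma exp_abs_le (y : ℝ) : Real.exp |y| ≤ Real.exp y + Real.exp (-y) := by
  rcases abs_cases y with h | h <;> rw [h.1] <;> linarith [Real.exp_pos y, Real.exp_pos (-y)]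

lemma finish {ι : Type*} (S : Finset ι) (w w' X X' : ι → ℝ) (K K₁ C μ n : ℝ)
    (hw : ∀ i ∈ S, 0 ≤ w i) (hW : 0 < ∑ i ∈ S, w i) (hK : 1 ≤ K) (hK₁ : 0 ≤ K₁) (hC : 0 ≤ C)
    (hn : 1 ≤ n)
    (hww' : ∀ i ∈ S, w i ≤ K * w' i) (hw'w : ∀ i ∈ S, w' i ≤ K * w i)
    (hX : ∀ i ∈ S, |X i - X' i| ≤ K₁)
    (hb : ∀ t : ℝ, |t| ≤ 2 → ∑ i ∈ S, w' i * Real.exp (t * (X' i - μ)) ≤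
      Real.exp (C * n * t ^ 2) * ∑ i ∈ S, w' i)
    (t : ℝ) (ht : |t| ≤ 1) :
    (∑ i ∈ S, w i * Real.exp (t * (X i - (∑ i ∈ S, w i * X i) / ∑ i ∈ S, w i))) /
        (∑ i ∈ S, w i) ≤
      Real.exp ((2 * C + 2 * Real.log (2 * K ^ 2 * Real.exp (2 * K₁)) +
        2 * (2 * K ^ 2 * Real.exp (2 * K₁)) ^ 2 * Real.exp (8 * C)) * n * t ^ 2) := by
  set W := ∑ i ∈ S, w i with hWdef
  set m := (∑ i ∈ S, w i * X i) / W with hm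
  set K₂ := 2 * K ^ 2 * Real.exp (2 * K₁) with hK₂
  have hK₂1 : 1 ≤ K₂ := by
    have h1 : 1 ≤ Real.exp (2 * K₁) := Real.one_le_exp (by positivity)
    have h2 : 1 ≤ K ^ 2 := one_le_pow₀ hK
    nlinarith
  have hmW : W * m = ∑ i ∈ S, w i * X i := by rw [hm, mul_div_cancel₀ _ hW.ne']
  have hW' : ∑ i ∈ S, w' i ≤ K * W := by
    rw [hWdef, Finset.mul_sum]; exact Finset.sum_le_sum hw'w
  have step1 : ∀ s : ℝ, 0 ≤ s → s ≤ 2 →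
      ∑ i ∈ S, w i * Real.exp (s * |X i - μ|) ≤ K₂ * Real.exp (C * n * s ^ 2) * W := by
    intro s hs0 hs2
    have b1 := hb s (by rwa [abs_of_nonneg hs0])
    have b2 := hb (-s) (by rwa [abs_neg, abs_of_nonneg hs0])
    rw [neg_sq] at b2
    have : ∑ i ∈ S, w i * Real.exp (s * |X i - μ|) ≤
        K * Real.exp (2 * K₁) * (∑ i ∈ S, w' i * Real.exp (s * (X' i - μ)) +
          ∑ i ∈ S, w' i * Real.exp (-s * (X' i - μ))) := by
      rw [← Finset.sum_add_distrib, Finset.mul_sum]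
      refine Finset.sum_le_sum fun i hi => ?_
      have h1 : Real.exp (s * |X i - μ|) ≤ Real.exp (2 * K₁) *
          (Real.exp (s * (X' i - μ)) + Real.exp (-s * (X' i - μ))) := by
        have h2 : s * |X i - μ| ≤ 2 * K₁ + |s * (X' i - μ)| := by
          rw [abs_mul, abs_of_nonneg hs0]
          have h3 := abs_sub_le (X i) (X' i) μ
          have h4 := hX i hi
          have h5 : s * |X i - μ| ≤ s * (K₁ + |X' i - μ|) :=
            mul_le_mul_of_nonneg_left (by linarith) hs0
          have h6 : s * K₁ ≤ 2 * K₁ := mul_le_mul_of_nonneg_right hs2 hK₁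
          linarith
        refine (Real.exp_le_exp.2 h2).trans ?_
        rw [Real.exp_add, neg_mul]
        exact mul_le_mul_of_nonneg_left (exp_abs_le _) (Real.exp_pos _).le
      calc _ ≤ (K * w' i) * (Real.exp (2 * K₁) *
          (Real.exp (s * (X' i - μ)) + Real.exp (-s * (X' i - μ)))) :=
            mul_le_mul (hww' i hi) h1 (Real.exp_pos _).le ((hw i hi).trans (hww' i hi))
        _ = _ := by ring
    calc _ ≤ _ := this
      _ ≤ K * Real.exp (2 * K₁) * (Real.exp (C * n * s ^ 2) * (K * W) +
          Real.exp (C * n * s ^ 2) * (K * W)) := by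
        refine mul_le_mul_of_nonneg_left ?_ (by positivity)
        have h7 := mul_le_mul_of_nonneg_left hW' (Real.exp_pos (C * n * s ^ 2)).le
        linarith
      _ = _ := by rw [hK₂]; ring
  have step2 : ∀ s : ℝ, 0 ≤ s →
      Real.exp (s * |m - μ|) * W ≤ ∑ i ∈ S, w i * Real.exp (s * |X i - μ|) := by
    intro s hs0
    have h1 : W * |m - μ| ≤ ∑ i ∈ S, w i * |X i - μ| := by
      rw [← abs_of_pos hW, ← abs_mul, mul_sub, hmW, hWdef, Finset.sum_mul,
        ← Finset.sum_sub_distrib]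
      refine (Finset.abs_sum_le_sum_abs _ _).trans (Finset.sum_le_sum fun i hi => ?_)
      rw [← mul_sub, abs_mul, abs_of_nonneg (hw i hi)]
    set b := s * |m - μ| with hb'
    calc Real.exp b * W ≤ Real.exp b * (W + s * (∑ i ∈ S, w i * |X i - μ|) - b * W) := by
          refine mul_le_mul_of_nonneg_left ?_ (Real.exp_pos _).le
          have := mul_le_mul_of_nonneg_left h1 hs0
          have e : b * W = s * (W * |m - μ|) := by rw [hb']; ring
          linarith
      _ = ∑ i ∈ S, w i * (Real.exp b * (1 + s * |X i - μ| - b)) := by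
          rw [hWdef, mul_sub, mul_add]
          simp only [Finset.mul_sum]
          rw [← Finset.sum_add_distrib, ← Finset.sum_sub_distrib]
          exact Finset.sum_congr rfl fun i _ => by ring
      _ ≤ _ := by
          refine Finset.sum_le_sum fun i hi => mul_le_mul_of_nonneg_left ?_ (hw i hi)
          have h2 := Real.add_one_le_exp (s * |X i - μ| - b)
          calc _ ≤ Real.exp b * Real.exp (s * |X i - μ| - b) := by
                refine mul_le_mul_of_nonneg_left ?_ (Real.exp_pos _).le
                linarith
            _ = _ := by rw [← Real.exp_add]; congr 1; ring
  have step3 : ∀ s : ℝ, 0 ≤ s → s ≤ 2 →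
      ∑ i ∈ S, w i * Real.exp (s * |X i - m|) ≤ K₂ ^ 2 * Real.exp (2 * C * n * s ^ 2) * W := by
    intro s hs0 hs2
    have h1 := step1 s hs0 hs2
    have h2 := (step2 s hs0).trans h1
    have h3 : Real.exp (s * |m - μ|) ≤ K₂ * Real.exp (C * n * s ^ 2) :=
      le_of_mul_le_mul_right h2 hW
    calc _ ≤ Real.exp (s * |m - μ|) * ∑ i ∈ S, w i * Real.exp (s * |X i - μ|) := by
          rw [Finset.mul_sum]
          refine Finset.sum_le_sum fun i hi => ?_
          have : Real.exp (s * |X i - m|) ≤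
              Real.exp (s * |m - μ|) * Real.exp (s * |X i - μ|) := by
            rw [← Real.exp_add, Real.exp_le_exp, ← mul_add]
            refine mul_le_mul_of_nonneg_left ?_ hs0
            have := abs_sub_le (X i) μ m
            rw [abs_sub_comm μ m] at this
            linarith
          calc _ ≤ w i * (Real.exp (s * |m - μ|) * Real.exp (s * |X i - μ|)) :=
                mul_le_mul_of_nonneg_left this (hw i hi)
            _ = _ := by ring
      _ ≤ (K₂ * Real.exp (C * n * s ^ 2)) * (K₂ * Real.exp (C * n * s ^ 2) * W) := by
          refine mul_le_mul h3 h1 ?_ (by positivity)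
          exact Finset.sum_nonneg fun i hi => mul_nonneg (hw i hi) (Real.exp_pos _).le
      _ = _ := by
          rw [show 2 * C * n * s ^ 2 = C * n * s ^ 2 + C * n * s ^ 2 by ring, Real.exp_add]; ring
  have hlog : 0 ≤ Real.log K₂ := Real.log_nonneg hK₂1
  have hK₂pos : 0 < K₂ := by linarith
  rw [div_le_iff₀ hW]
  rcases le_total 1 (n * t ^ 2) with hcase | hcase
  · have h1 := step3 |t| (abs_nonneg t) (ht.trans (by norm_num))
    have h2 : ∑ i ∈ S, w i * Real.exp (t * (X i - m)) ≤
        ∑ i ∈ S, w i * Real.exp (|t| * |X i - m|) := by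
      refine Finset.sum_le_sum fun i hi => mul_le_mul_of_nonneg_left ?_ (hw i hi)
      rw [Real.exp_le_exp, ← abs_mul]; exact le_abs_self _
    refine h2.trans (h1.trans (mul_le_mul_of_nonneg_right ?_ hW.le))
    rw [sq_abs]
    have h3 : K₂ ^ 2 = Real.exp (2 * Real.log K₂) := by
      rw [two_mul, Real.exp_add, Real.exp_log hK₂pos]; ring
    rw [h3, ← Real.exp_add, Real.exp_le_exp]
    have h4 : 2 * Real.log K₂ * 1 ≤ 2 * Real.log K₂ * (n * t ^ 2) :=
      mul_le_mul_of_nonneg_left hcase (by positivity)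
    have h5 : 0 ≤ 2 * Real.exp (2 * Real.log K₂) * Real.exp (8 * C) * (n * t ^ 2) := by positivity
    rw [h3] at *
    linarith
  · have hn0 : 0 < n := by linarith
    have hsq : 0 < Real.sqrt n := Real.sqrt_pos.2 hn0
    have hsqsq : Real.sqrt n ^ 2 = n := Real.sq_sqrt hn0.le
    have hsq1 : 1 ≤ Real.sqrt n := Real.one_le_sqrt.2 hn
    set s := 1 / Real.sqrt n with hs
    have hs0 : 0 < s := by positivity
    have hs1 : s ≤ 1 := by rw [hs, div_le_one hsq]; exact hsq1
    have hsn : n * s ^ 2 = 1 := by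
      rw [hs, div_pow, hsqsq]; field_simp
    have hts : |t| ≤ s := by
      refine abs_le_of_sq_le_sq ?_ hs0.le
      have : n * t ^ 2 ≤ n * s ^ 2 := by rw [hsn]; exact hcase
      exact le_of_mul_le_mul_left this hn0
    have h1 := step3 (2 * s) (by positivity) (by linarith)
    rw [show 2 * C * n * (2 * s) ^ 2 = 8 * C * (n * s ^ 2) by ring, hsn, mul_one] at h1
    have hpt : ∀ y : ℝ, Real.exp (t * y) ≤
        1 + t * y + 2 * (n * t ^ 2) * Real.exp (2 * s * |y|) := by
      intro y
      have h2 := exp_quad (t * y)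
      have h3 : Real.exp |t * y| ≤ Real.exp (s * |y|) := by
        rw [Real.exp_le_exp, abs_mul]; exact mul_le_mul_of_nonneg_right hts (abs_nonneg y)
      have h4 : (s * |y|) ^ 2 ≤ 2 * Real.exp (s * |y|) := by
        have := Real.quadratic_le_exp_of_nonneg (x := s * |y|) (by positivity)
        have : 0 ≤ s * |y| := by positivity
        linarith
      have h5 : (t * y) ^ 2 = n * t ^ 2 * (s * |y|) ^ 2 := by
        have : n * t ^ 2 * (s * |y|) ^ 2 = (n * s ^ 2) * t ^ 2 * |y| ^ 2 := by ring
        rw [this, hsn, sq_abs]; ring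
      have h6 : Real.exp (2 * s * |y|) = Real.exp (s * |y|) * Real.exp (s * |y|) := by
        rw [← Real.exp_add]; congr 1; ring
      have h7 : (t * y) ^ 2 * Real.exp |t * y| ≤
          n * t ^ 2 * (2 * Real.exp (s * |y|)) * Real.exp (s * |y|) := by
        rw [h5]
        refine mul_le_mul ?_ h3 (Real.exp_pos _).le (by positivity)
        exact mul_le_mul_of_nonneg_left h4 (by positivity)
      rw [h6]
      linarith
    have h8 : ∑ i ∈ S, w i * Real.exp (t * (X i - m)) ≤
        W + 2 * (n * t ^ 2) * ∑ i ∈ S, w i * Real.exp (2 * s * |X i - m|) := by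
      have e : ∑ i ∈ S, w i * (1 + t * (X i - m) +
          2 * (n * t ^ 2) * Real.exp (2 * s * |X i - m|)) =
          W + t * ((∑ i ∈ S, w i * X i) - W * m) +
          2 * (n * t ^ 2) * ∑ i ∈ S, w i * Real.exp (2 * s * |X i - m|) := by
        rw [hWdef, mul_sub, Finset.sum_mul]
        simp only [Finset.mul_sum]
        rw [← Finset.sum_sub_distrib, ← Finset.sum_add_distrib, ← Finset.sum_add_distrib]
        exact Finset.sum_congr rfl fun i _ => by ring
      rw [hmW, sub_self, mul_zero, add_zero] at e
      rw [← e]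
      exact Finset.sum_le_sum fun i hi => mul_le_mul_of_nonneg_left (hpt _) (hw i hi)
    have hnt : 0 ≤ n * t ^ 2 := by positivity
    calc _ ≤ _ := h8
      _ ≤ W + 2 * (n * t ^ 2) * (K₂ ^ 2 * Real.exp (8 * C) * W) := by
          have := mul_le_mul_of_nonneg_left h1 (by positivity : 0 ≤ 2 * (n * t ^ 2))
          linarith
      _ = (2 * K₂ ^ 2 * Real.exp (8 * C) * (n * t ^ 2) + 1) * W := by ring
      _ ≤ _ := by
          refine mul_le_mul_of_nonneg_right ((Real.add_one_le_exp _).trans ?_) hW.le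
          rw [Real.exp_le_exp]
          have h9 : 0 ≤ (2 * C + 2 * Real.log K₂) * (n * t ^ 2) := by positivity
          linarith

/-- Proposition 3.5, inequality (3.21): exponential moment bound for `c(η_x)`
under the canonical measure. -/
theorem statement5
    (c : ℕ → ℝ) (a₁ a₂ : ℝ) (k₀ : ℕ)
    (hc0 : c 0 = 0) (hcpos : ∀ n : ℕ, 0 < n → 0 < c n)
    (hLG : ∀ k : ℕ, |c (k + 1) - c k| ≤ a₁)
    (hk₀ : 0 < k₀) (ha₂ : 0 < a₂)
    (hM : ∀ j k : ℕ, j + k₀ ≤ k → a₂ ≤ c k - c j)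
    (L : ℕ) (hL : 1 ≤ L) :
    ∃ A : ℝ, 0 < A ∧ ∀ (a : ℤ) (x : ℤ) (N : ℕ), x ∈ Finset.Ico a (a + (L : ℤ)) → 1 ≤ N →
      ∀ t : ℝ, -1 ≤ t → t ≤ 1 →
        wE (nuW c (Finset.Ico a (a + (L : ℤ))) N)
          (fun η => Real.exp (t * (c (η x) -
            wE (nuW c (Finset.Ico a (a + (L : ℤ))) N) (fun ξ => c (ξ x)))))
        ≤ Real.exp (A * (N : ℝ) * t ^ 2) := by
  classical
  obtain ⟨c', K, K₁, hK, hK₁, hc'0, hc'pos, hc'mono, hdiff, hle, hge⟩ :=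
    smooth c a₁ a₂ k₀ hc0 hcpos hLG hk₀ ha₂ hM
  have ha₁ : 0 ≤ a₁ := (abs_nonneg _).trans (hLG 0)
  set D := a₁ + 2 * K₁ with hDdef
  have hD : 0 ≤ D := by positivity
  have hinc : ∀ n, c' (n + 1) ≤ c' n + D := by
    intro n
    have h1 := abs_le.1 (hdiff n)
    have h2 := abs_le.1 (hdiff (n + 1))
    have h3 := abs_le.1 (hLG n)
    linarith [h1.2, h2.1, h3.2]
  have hgood : GoodW (fun n => (cfact c' n)⁻¹) c' := by
    refine ⟨fun n => inv_pos.2 (cfact_pos hc'pos n), hc'0, fun n => ?_, hc'mono⟩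
    have h1 := (cfact_pos hc'pos n).ne'
    have h2 := (hc'pos (n + 1) n.succ_pos).ne'
    simp only [cfact]
    field_simp
  set C := D ^ 2 * Real.exp (2 * D) with hCdef
  have hC : 0 ≤ C := by positivity
  have hKL : 1 ≤ K ^ L := one_le_pow₀ hK
  refine ⟨2 * C + 2 * Real.log (2 * (K ^ L) ^ 2 * Real.exp (2 * K₁)) +
        2 * (2 * (K ^ L) ^ 2 * Real.exp (2 * K₁)) ^ 2 * Real.exp (8 * C), ?_, ?_⟩
  · have h1 : 0 ≤ Real.log (2 * (K ^ L) ^ 2 * Real.exp (2 * K₁)) := by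
      apply Real.log_nonneg
      have h1 : 1 ≤ Real.exp (2 * K₁) := Real.one_le_exp (by positivity)
      have h2 : 1 ≤ (K ^ L) ^ 2 := one_le_pow₀ hKL
      nlinarith
    positivity
  intro a x N hx hN t ht1 ht2
  set Λ := Finset.Ico a (a + (L : ℤ)) with hΛ
  have hcard : Λ.card = L := by simp [hΛ]
  have hsum : ∀ F : (ℤ → ℕ) → ℝ, ∑' η : ℤ → ℕ, nuW c Λ N η * F η =
      ∑ η ∈ Finset.piAntidiag Λ N, (∏ y ∈ Λ, (cfact c (η y))⁻¹) * F η := by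
    intro F
    rw [tsum_eq_sum (s := Finset.piAntidiag Λ N)]
    · refine Finset.sum_congr rfl fun η hη => ?_
      rw [Finset.mem_piAntidiag] at hη
      rw [nuW, Set.indicator_of_mem]
      exact ⟨fun y hy => by_contra fun h => hy (hη.2 y h), hη.1⟩
    · intro η hη
      rw [nuW, Set.indicator_of_notMem, zero_mul]
      rintro ⟨h1, h2⟩
      exact hη (Finset.mem_piAntidiag.2 ⟨h2, fun y hy => by_contra fun h => hy (h1 y h)⟩)
  have hsum1 : ∑' η : ℤ → ℕ, nuW c Λ N η =
      ∑ η ∈ Finset.piAntidiag Λ N, ∏ y ∈ Λ, (cfact c (η y))⁻¹ := by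
    simpa using hsum (fun _ => 1)
  obtain ⟨μ, hμ⟩ := site_bound hgood hD hinc N Λ x hx
  have hne : (Finset.piAntidiag Λ N).Nonempty := by
    refine ⟨Pi.single x N, Finset.mem_piAntidiag.2 ⟨?_, ?_⟩⟩
    · simp [Finset.sum_pi_single', Pi.single_apply, hx]
    · intro y hy
      by_contra h
      have : y ≠ x := fun e => h (e ▸ hx)
      simp [this] at hy
  have hcmp : ∀ u v : ℕ → ℝ, (∀ n, 0 ≤ u n) → (∀ n, u n ≤ K * v n) → ∀ η : ℤ → ℕ,
      ∏ y ∈ Λ, u (η y) ≤ K ^ L * ∏ y ∈ Λ, v (η y) := by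
    intro u v hu huv η
    calc _ ≤ ∏ y ∈ Λ, (K * v (η y)) := Finset.prod_le_prod (fun y _ => hu _) fun y _ => huv _
      _ = _ := by rw [Finset.prod_mul_distrib, Finset.prod_const, hcard]
  have hpos : ∀ n, 0 < (cfact c n)⁻¹ := fun n => inv_pos.2 (cfact_pos hcpos n)
  have hmain := finish (Finset.piAntidiag Λ N) (fun η => ∏ y ∈ Λ, (cfact c (η y))⁻¹)
    (fun η => ∏ y ∈ Λ, (cfact c' (η y))⁻¹) (fun η => c (η x)) (fun η => c' (η x))
    (K ^ L) K₁ C μ N (fun η _ => Finset.prod_nonneg fun y _ => (hpos _).le)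
    (Finset.sum_pos (fun η _ => Finset.prod_pos fun y _ => hpos _) hne) hKL hK₁ hC
    (by exact_mod_cast hN)
    (fun η _ => hcmp (fun n => (cfact c n)⁻¹) (fun n => (cfact c' n)⁻¹) (fun n => (hpos n).le) hle η)
    (fun η _ => hcmp (fun n => (cfact c' n)⁻¹) (fun n => (cfact c n)⁻¹)
      (fun n => (hgood.pos n).le) hge η)
    (fun η _ => hdiff _) hμ t (abs_le.2 ⟨ht1, ht2⟩)
  simp only [wE]
  rw [hsum, hsum, hsum1]
  exact hmain
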